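/- Fix q ∈ (0,1), d ≥ 1, k ∈ ℕ, a countable subset Z ⊆ ℝ^d and a countable subset P ⊆ (0,∞). Then there exists a single k-layer MP-GNN h with damping q whose intermediate dimensions satisfy d_1 = ⋯ = d_{k+1} = 1 (i.e. φ_1 : ℝ^d → ℝ and φ_2,…,φ_{k+1}, ψ : ℝ → ℝ are Lipschitz) such that for all labeled weighted graphs (G₁,ℓ_{G₁}), (G₂,ℓ_{G₂}) with vertex labels in Z and edge weights in P: d_{G,q}^(k)((G₁,ℓ_{G₁}),(G₂,ℓ_{G₂})) > 0 if and only if h((G₁,ℓ_{G₁})) ≠ h((G₂,ℓ_{G₂})). -/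

import Mathlib

open Finset

noncomputable section

/-- An ℝ^d-labeled finite edge-weighted graph: nonempty vertex set `Fin n`, symmetric
nonnegative weights with zero diagonal (an edge is present exactly when its weight is
positive), and vertex labels in `ℝ^d`. -/
structure LabeledGraph (d : ℕ) where
  n : ℕ
  n_pos : 0 < n
  w : Fin n → Fin n → ℝ
  w_nonneg : ∀ u v, 0 ≤ w u v
  w_symm : ∀ u v, w u v = w v u
  w_loopless : ∀ v, w v v = 0
  label : Fin n → EuclideanSpace ℝ (Fin d)

namespace LabeledGraph

variable {d : ℕ}

/-- The (weighted) degree `deg(v) = Σ_{v'} w_{vv'}`. -/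
def deg (G : LabeledGraph d) (v : Fin G.n) : ℝ := ∑ v', G.w v v'

/-- The modified degree `d̄eg(v)`. -/
def dbar (G : LabeledGraph d) (v : Fin G.n) : ℝ := if 0 < G.deg v then G.deg v else 1

/-- The stationary measure `μ_G(v) = d̄eg(v)/Σ_{v'} d̄eg(v')`. -/
def statMeas (G : LabeledGraph d) (v : Fin G.n) : ℝ := G.dbar v / ∑ v', G.dbar v'

/-- The `q`-damped Markov kernel `m^{G,q}` of the graph, by its value at `v'`. -/
def kernel (G : LabeledGraph d) (q : ℝ) (v v' : Fin G.n) : ℝ :=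
  if 0 < G.deg v then (if v' = v then q else 0) + (1 - q) * G.w v v' / G.deg v
  else if v' = v then 1 else 0

end LabeledGraph

/-- `π` is a coupling of the two probability vectors `p : A → ℝ` and `p' : B → ℝ`. -/
def IsCouplingFn {A B : Type*} [Fintype A] [Fintype B] (π : A × B → ℝ)
    (p : A → ℝ) (p' : B → ℝ) : Prop :=
  (∀ r, 0 ≤ π r) ∧ (∀ a, ∑ b, π (a, b) = p a) ∧ (∀ b, ∑ a, π (a, b) = p' b)

/-- A 1-step coupling between the Markov kernels `mA` and `mB`. -/
def IsOneStepCoupling {A B : Type*} [Fintype A] [Fintype B]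
    (mA : A → A → ℝ) (mB : B → B → ℝ) (ν : A × B → A × B → ℝ) : Prop :=
  ∀ p, IsCouplingFn (ν p) (mA p.1) (mB p.2)

/-- `k`-step couplings between the Markov kernels `mA` and `mB` (for `k = 0`, the identity
kernel, so that `ν^{(0)} ⊙ γ = γ`). -/
inductive IsKStepCoupling {A B : Type*} [Fintype A] [Fintype B] [DecidableEq A] [DecidableEq B]
    (mA : A → A → ℝ) (mB : B → B → ℝ) : ℕ → (A × B → A × B → ℝ) → Prop
  | zero (ν : A × B → A × B → ℝ) (h : ∀ p r, ν p r = if r = p then 1 else 0) :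
      IsKStepCoupling mA mB 0 ν
  | one (ν : A × B → A × B → ℝ) (h : IsOneStepCoupling mA mB ν) : IsKStepCoupling mA mB 1 ν
  | succ (k : ℕ) (ν' ν₁ ν : A × B → A × B → ℝ) (h' : IsKStepCoupling mA mB k ν')
      (h₁ : IsOneStepCoupling mA mB ν₁) (h : ∀ p r, ν p r = ∑ s, ν₁ p s * ν' s r) :
      IsKStepCoupling mA mB (k + 1) ν

/-- `ν ⊙ γ := ∫ ν_{x,y} γ(dx×dy)`. -/
def odotFn {A B : Type*} [Fintype A] [Fintype B]
    (ν : A × B → A × B → ℝ) (γ : A × B → ℝ) : A × B → ℝ :=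
  fun r => ∑ p, γ p * ν p r

/-- The Weisfeiler–Lehman distance of depth `k` between two labeled measure Markov chains on
finite state spaces, via its `k`-step coupling characterization: the infimum over
`γ^{(k)} = ν^{(k)} ⊙ γ ∈ C^{(k)}(μ_A,μ_B)` of `∫ d_Z(ℓ_A(x),ℓ_B(y)) γ^{(k)}(dx×dy)`. -/
def dWL {A B Z : Type*} [Fintype A] [Fintype B] [DecidableEq A] [DecidableEq B]
    [PseudoMetricSpace Z] (k : ℕ)
    (mA : A → A → ℝ) (μA : A → ℝ) (lA : A → Z)
    (mB : B → B → ℝ) (μB : B → ℝ) (lB : B → Z) : ℝ :=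
  sInf {r : ℝ | ∃ γ ν, IsCouplingFn γ μA μB ∧ IsKStepCoupling mA mB k ν ∧
    r = ∑ p : A × B, odotFn ν γ p * dist (lA p.1) (lB p.2)}

/-- The `q`-damped WL distance of depth `k` between labeled graphs. -/
def dGq {d : ℕ} (q : ℝ) (k : ℕ) (G₁ G₂ : LabeledGraph d) : ℝ :=
  dWL k (G₁.kernel q) G₁.statMeas G₁.label (G₂.kernel q) G₂.statMeas G₂.label

/-- Dimension sequence with prescribed initial value `d` and tail `t`. -/
def dimSeq (d : ℕ) (t : ℕ → ℕ) : ℕ → ℕ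
  | 0 => d
  | i + 1 => t i

/-- The node features `ℓ_G^i` computed by the message-passing layers of an MP-GNN with
damping `q` and maps `φ` (here `φ i` is the paper's `φ_{i+1}`). -/
def gnnLabel (q : ℝ) (dims : ℕ → ℕ)
    (φ : (i : ℕ) → EuclideanSpace ℝ (Fin (dims i)) → EuclideanSpace ℝ (Fin (dims (i + 1))))
    (G : LabeledGraph (dims 0)) : (i : ℕ) → Fin G.n → EuclideanSpace ℝ (Fin (dims i))
  | 0, v => G.label v
  | i + 1, v =>
    if 0 < G.deg v then
      q • φ i (gnnLabel q dims φ G i v) +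
        ((1 - q) / G.deg v) • ∑ v', G.w v v' • φ i (gnnLabel q dims φ G i v')
    else φ i (gnnLabel q dims φ G i v)

/-- The output of a `k`-layer MP-GNN with damping `q`:
`h(G) = ψ( Σ_v (d̄eg(v)/Σ d̄eg) φ_{k+1}(ℓ_G^k(v)) )`. -/
def gnnOut (q : ℝ) (dims : ℕ → ℕ) (k : ℕ)
    (φ : (i : ℕ) → EuclideanSpace ℝ (Fin (dims i)) → EuclideanSpace ℝ (Fin (dims (i + 1))))
    (ψ : EuclideanSpace ℝ (Fin (dims (k + 1))) → ℝ)
    (G : LabeledGraph (dims 0)) : ℝ :=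
  ψ (∑ v, G.statMeas v • φ k (gnnLabel q dims φ G k v))

end

noncomputable section

/-- One message-passing aggregation step with damping `q` on a vector-valued node feature. -/
def agg (q : ℝ) {d : ℕ} (G : LabeledGraph d) {F : Type*} [AddCommGroup F] [Module ℝ F]
    (f : Fin G.n → F) (v : Fin G.n) : F :=
  if 0 < G.deg v then q • f v + ((1 - q) / G.deg v) • ∑ v', G.w v v' • f v' else f v

/-- The real-valued node features `ℓ_G^{j+1}` of an MP-GNN whose intermediate dimensions are
all `1`: `φ₀ : ℝ^d → ℝ` is the paper's `φ_1` and `φ j : ℝ → ℝ` is the paper's `φ_{j+2}`.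
Here `lab1 q G φ₀ φ j = ℓ_G^{j+1}`. -/
def lab1 (q : ℝ) {d : ℕ} (G : LabeledGraph d) (φ₀ : EuclideanSpace ℝ (Fin d) → ℝ)
    (φ : ℕ → ℝ → ℝ) : ℕ → Fin G.n → ℝ
  | 0 => agg q G (fun v => φ₀ (G.label v))
  | j + 1 => agg q G (fun v => φ j (lab1 q G φ₀ φ j v))

/-- The output of a `k`-layer MP-GNN with damping `q` whose intermediate dimensions are
all `1`: `h(G) = ψ( Σ_v (d̄eg(v)/Σ d̄eg) φ_{k+1}(ℓ_G^k(v)) )`. -/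
def gnn1Out (q : ℝ) {d : ℕ} (φ₀ : EuclideanSpace ℝ (Fin d) → ℝ) (φ : ℕ → ℝ → ℝ)
    (ψ : ℝ → ℝ) (k : ℕ) (G : LabeledGraph d) : ℝ :=
  match k with
  | 0 => ψ (∑ v, G.statMeas v * φ₀ (G.label v))
  | j + 1 => ψ (∑ v, G.statMeas v * φ j (lab1 q G φ₀ φ j v))

end

/-- The tent functions of radius at most one around the points of `X`, evaluated at `x`. -/
noncomputable def tentEmbedding {X : Type*} [MetricSpace X] (x : X) :
    BoundedContinuousFunction (X × unitInterval) ℝ :=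
  BoundedContinuousFunction.ofNormedAddCommGroup
    (fun y => max 0 ((y.2 : ℝ) - dist x y.1)) (by fun_prop) 1 (by
      rintro ⟨y, r⟩
      rw [Real.norm_eq_abs, abs_of_nonneg (le_max_left _ _)]
      exact max_le zero_le_one (by linarith [r.2.2, dist_nonneg (x := x) (y := y)]))

theorem tentEmbedding_apply {X : Type*} [MetricSpace X] (x : X) (y : X × unitInterval) :
    tentEmbedding x y = max 0 ((y.2 : ℝ) - dist x y.1) := rfl

theorem lipschitzWith_tentEmbedding {X : Type*} [MetricSpace X] :
    LipschitzWith 1 (tentEmbedding : X → BoundedContinuousFunction (X × unitInterval) ℝ) := by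
  refine LipschitzWith.of_dist_le_mul fun x x' => ?_
  rw [NNReal.coe_one, one_mul]
  refine (BoundedContinuousFunction.dist_le dist_nonneg).2 fun y => ?_
  rw [tentEmbedding_apply, tentEmbedding_apply, Real.dist_eq]
  rw [max_comm 0, max_comm 0]
  refine (abs_max_sub_max_le_abs _ _ _).trans ?_
  rw [show (y.2 : ℝ) - dist x y.1 - (y.2 - dist x' y.1) = -(dist x y.1 - dist x' y.1) by ring,
    abs_neg]
  exact abs_dist_sub_le x x' y.1

theorem linearIndependent_tentEmbedding {X : Type*} [MetricSpace X] :
    LinearIndependent ℝ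
      (tentEmbedding : X → BoundedContinuousFunction (X × unitInterval) ℝ) := by
  classical
  rw [linearIndependent_iff']
  intro s g hg i hi
  obtain ⟨r, hr0, hr1, hr⟩ : ∃ r : ℝ, 0 < r ∧ r ≤ 1 ∧ ∀ j ∈ s, j ≠ i → r ≤ dist j i := by
    have hfin : ∀ᶠ r : ℝ in nhdsWithin 0 (Set.Ioi 0), ∀ j ∈ s, j ≠ i → r ≤ dist j i := by
      rw [Filter.eventually_all_finset]
      intro j _
      by_cases hji : j = i
      · simp [hji]
      · filter_upwards [Ioo_mem_nhdsGT (dist_pos.2 hji)] with r hr _ using hr.2.le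
    obtain ⟨r, hr, hr'⟩ := (hfin.and (Ioo_mem_nhdsGT one_pos)).exists
    exact ⟨r, hr'.1, hr'.2.le, hr⟩
  have h := congrArg (fun f : BoundedContinuousFunction (X × unitInterval) ℝ =>
    f (i, ⟨r, hr0.le, hr1⟩)) hg
  simp only [BoundedContinuousFunction.coe_sum, Finset.sum_apply,
    BoundedContinuousFunction.coe_smul, tentEmbedding_apply, smul_eq_mul,
    BoundedContinuousFunction.coe_zero, Pi.zero_apply] at h
  rw [Finset.sum_eq_single_of_mem i hi] at h
  · rw [dist_self, sub_zero, max_eq_right hr0.le] at h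
    exact (mul_eq_zero.1 h).resolve_right hr0.ne'
  · intro j hj hji
    rw [max_eq_left (by linarith [hr j hj hji]), mul_zero]

/-- Some continuous functional vanishes at no member of a countable family of nonzero vectors. -/
theorem exists_strongDual_forall_ne_zero {V : Type*} [NormedAddCommGroup V] [NormedSpace ℝ V]
    (A : Set V) (hA : A.Countable) :
    ∃ c : StrongDual ℝ V, ∀ a ∈ A, a ≠ 0 → c a ≠ 0 := by
  have hB : (A \ {0}).Countable := hA.mono Set.sdiff_subset
  have hdense : Dense (⋂ a ∈ A \ {0}, {c : StrongDual ℝ V | c a ≠ 0}) := by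
    refine dense_biInter_of_isOpen (fun a _ => ?_) hB (fun a ha => ?_)
    · exact isOpen_ne.preimage (ContinuousLinearMap.apply ℝ ℝ a).continuous
    · have hne : ((ContinuousLinearMap.apply ℝ ℝ a : StrongDual ℝ V →L[ℝ] ℝ) :
          StrongDual ℝ V →ₗ[ℝ] ℝ).ker ≠ ⊤ := by
        intro htop
        obtain ⟨g, -, hg⟩ := exists_dual_vector ℝ a (norm_ne_zero_iff.2 ha.2)
        have : g ∈ ((ContinuousLinearMap.apply ℝ ℝ a : StrongDual ℝ V →L[ℝ] ℝ) :
          StrongDual ℝ V →ₗ[ℝ] ℝ).ker := htop ▸ Submodule.mem_top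
        have h0 : g a = 0 := this
        rw [h0] at hg
        exact ha.2 (norm_eq_zero.1 (by exact_mod_cast hg.symm))
      have hint := mt (Submodule.eq_top_of_nonempty_interior' _) hne
      rw [Set.not_nonempty_iff_eq_empty, interior_eq_empty_iff_dense_compl] at hint
      exact hint
  obtain ⟨c, hc⟩ := hdense.nonempty
  exact ⟨c, fun a ha h0 => Set.mem_iInter₂.1 hc a ⟨ha, h0⟩⟩

/-- A single Lipschitz function separates a countable set of finitely supported measures. -/
theorem exists_lipschitz_injOn_linearCombination {X : Type*} [MetricSpace X]
    (A : Set (X →₀ ℝ)) (hA : A.Countable) :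
    ∃ φ : X → ℝ, (∃ c : NNReal, LipschitzWith c φ) ∧
      Set.InjOn (Finsupp.linearCombination ℝ φ) A := by
  obtain ⟨c, hc⟩ := exists_strongDual_forall_ne_zero
    ((fun a : (X →₀ ℝ) × (X →₀ ℝ) =>
      Finsupp.linearCombination ℝ (tentEmbedding (X := X)) (a.1 - a.2)) '' (A ×ˢ A))
    ((hA.prod hA).image _)
  refine ⟨fun x => c (tentEmbedding x), ⟨_, c.lipschitz.comp lipschitzWith_tentEmbedding⟩, ?_⟩
  intro a ha b hb hab
  by_contra hne
  refine hc _ ⟨(a, b), ⟨ha, hb⟩, rfl⟩ (fun h => hne ?_) ?_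
  · exact sub_eq_zero.1 ((linearIndependent_iff.1 linearIndependent_tentEmbedding) _ h)
  · have hcomp : ∀ f : X →₀ ℝ, c (Finsupp.linearCombination ℝ (tentEmbedding (X := X)) f) =
        Finsupp.linearCombination ℝ (fun x => c (tentEmbedding x)) f := by
      intro f
      simp [Finsupp.linearCombination_apply, Finsupp.sum, map_sum]
    simp only [hcomp, map_sub]
    exact sub_eq_zero.2 hab

/-- The pushforward along `f` of the weight vector `p`. -/
noncomputable def pushforward {A X : Type*} [Fintype A] (p : A → ℝ) (f : A → X) : X →₀ ℝ :=
  ∑ a, Finsupp.single (f a) (p a)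

theorem linearCombination_pushforward {A X : Type*} [Fintype A] (p : A → ℝ) (f : A → X)
    (φ : X → ℝ) :
    Finsupp.linearCombination ℝ φ (pushforward p f) = ∑ a, p a * φ (f a) := by
  simp [pushforward, map_sum]

theorem mapDomain_pushforward {A X Y : Type*} [Fintype A] (p : A → ℝ) (f : A → X) (φ : X → Y) :
    Finsupp.mapDomain φ (pushforward p f) = pushforward p (fun a => φ (f a)) := by
  simp [pushforward, Finsupp.mapDomain_finsetSum, Finsupp.mapDomain_single]

theorem pushforward_apply {A X : Type*} [Fintype A] [DecidableEq X] (p : A → ℝ) (f : A → X)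
    (x : X) : pushforward p f x = ∑ a, if f a = x then p a else 0 := by
  simp [pushforward, Finsupp.finsetSum_apply, Finsupp.single_apply]

/-- Weight vectors with the same pushforward have a coupling supported on the fibre product. -/
theorem exists_coupling_of_pushforward_eq {A B X : Type*} [Fintype A] [Fintype B]
    {p : A → ℝ} {p' : B → ℝ} (hp : ∀ a, 0 ≤ p a) (hp' : ∀ b, 0 ≤ p' b) (f : A → X) (g : B → X)
    (h : pushforward p f = pushforward p' g) :
    ∃ π : A × B → ℝ, IsCouplingFn π p p' ∧ ∀ r, π r ≠ 0 → f r.1 = g r.2 := by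
  classical
  set s := pushforward p f with hs
  have hs0 : ∀ x, 0 ≤ s x := fun x => by
    rw [hs, pushforward_apply]
    exact Finset.sum_nonneg fun a _ => by split_ifs <;> simp [hp]
  have hpz : ∀ a, s (f a) = 0 → p a = 0 := fun a ha => by
    rw [hs, pushforward_apply, Finset.sum_eq_zero_iff_of_nonneg
      (fun a _ => by split_ifs <;> simp [hp])] at ha
    simpa using ha a (Finset.mem_univ a)
  have hpz' : ∀ b, s (g b) = 0 → p' b = 0 := fun b hb => by
    rw [h, pushforward_apply, Finset.sum_eq_zero_iff_of_nonneg
      (fun a _ => by split_ifs <;> simp [hp'])] at hb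
    simpa using hb b (Finset.mem_univ b)
  refine ⟨fun r => if f r.1 = g r.2 then p r.1 * p' r.2 / s (f r.1) else 0, ⟨?_, ?_, ?_⟩, ?_⟩
  · intro r
    dsimp only
    split_ifs
    · exact div_nonneg (mul_nonneg (hp _) (hp' _)) (hs0 _)
    · exact le_rfl
  · intro a
    have : ∀ b, (if f a = g b then p a * p' b / s (f a) else 0) =
        p a / s (f a) * (if g b = f a then p' b else 0) := fun b => by
      by_cases hab : f a = g b
      · simp [hab]; ring
      · simp [hab, Ne.symm hab]
    simp only [this, ← Finset.mul_sum]
    rw [← pushforward_apply, ← h]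
    exact div_mul_cancel_of_imp (hpz a)
  · intro b
    have : ∀ a, (if f a = g b then p a * p' b / s (f a) else 0) =
        p' b / s (g b) * (if f a = g b then p a else 0) := fun a => by
      by_cases hab : f a = g b
      · simp [hab]; ring
      · simp [hab]
    simp only [this, ← Finset.mul_sum]
    rw [← pushforward_apply, ← hs]
    exact div_mul_cancel_of_imp (hpz' b)
  · intro r hr
    by_contra hne
    simp [hne] at hr

theorem exists_coupling_of_sum_eq {A B : Type*} [Fintype A] [Fintype B]
    {p : A → ℝ} {p' : B → ℝ} (hp : ∀ a, 0 ≤ p a) (hp' : ∀ b, 0 ≤ p' b)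
    (h : ∑ a, p a = ∑ b, p' b) : ∃ π : A × B → ℝ, IsCouplingFn π p p' := by
  obtain ⟨π, hπ, -⟩ := exists_coupling_of_pushforward_eq hp hp' (fun _ => ()) (fun _ => ())
    (by ext; simp [pushforward_apply, h])
  exact ⟨π, hπ⟩

theorem IsCouplingFn.abs_sum_sub_sum_le {A B : Type*} [Fintype A] [Fintype B] {π : A × B → ℝ}
    {p : A → ℝ} {p' : B → ℝ} (hπ : IsCouplingFn π p p') (f : A → ℝ) (g : B → ℝ) :
    |∑ a, p a * f a - ∑ b, p' b * g b| ≤ ∑ r, π r * |f r.1 - g r.2| := by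
  have h1 : ∑ a, p a * f a = ∑ r : A × B, π r * f r.1 := by
    rw [Fintype.sum_prod_type]
    exact Finset.sum_congr rfl fun a _ => by rw [← hπ.2.1 a, Finset.sum_mul]
  have h2 : ∑ b, p' b * g b = ∑ r : A × B, π r * g r.2 := by
    rw [Fintype.sum_prod_type_right]
    exact Finset.sum_congr rfl fun b _ => by rw [← hπ.2.2 b, Finset.sum_mul]
  rw [h1, h2, ← Finset.sum_sub_distrib]
  refine (Finset.abs_sum_le_sum_abs _ _).trans (Finset.sum_le_sum fun r _ => ?_)
  rw [← mul_sub, abs_mul, abs_of_nonneg (hπ.1 r)]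

namespace LabeledGraph

variable {d : ℕ}

theorem deg_nonneg (G : LabeledGraph d) (v : Fin G.n) : 0 ≤ G.deg v :=
  Finset.sum_nonneg fun _ _ => G.w_nonneg _ _

theorem dbar_pos (G : LabeledGraph d) (v : Fin G.n) : 0 < G.dbar v := by
  unfold dbar
  split_ifs with h
  · exact h
  · exact one_pos

theorem sum_dbar_pos (G : LabeledGraph d) : 0 < ∑ v, G.dbar v :=
  Finset.sum_pos (fun v _ => G.dbar_pos v) ⟨⟨0, G.n_pos⟩, Finset.mem_univ _⟩

theorem statMeas_nonneg (G : LabeledGraph d) (v : Fin G.n) : 0 ≤ G.statMeas v :=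
  div_nonneg (G.dbar_pos v).le G.sum_dbar_pos.le

theorem sum_statMeas (G : LabeledGraph d) : ∑ v, G.statMeas v = 1 := by
  simp only [statMeas, ← Finset.sum_div]
  exact div_self G.sum_dbar_pos.ne'

theorem kernel_nonneg (G : LabeledGraph d) {q : ℝ} (hq0 : 0 ≤ q) (hq1 : q ≤ 1)
    (v v' : Fin G.n) : 0 ≤ G.kernel q v v' := by
  unfold kernel
  split_ifs with h
  · exact add_nonneg hq0
      (div_nonneg (mul_nonneg (sub_nonneg.2 hq1) (G.w_nonneg _ _)) h.le)
  · exact add_nonneg le_rfl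
      (div_nonneg (mul_nonneg (sub_nonneg.2 hq1) (G.w_nonneg _ _)) h.le)
  · exact zero_le_one
  · exact le_rfl

theorem agg_eq_sum_kernel (G : LabeledGraph d) (q : ℝ) (f : Fin G.n → ℝ) (v : Fin G.n) :
    agg q G f v = ∑ v', G.kernel q v v' * f v' := by
  unfold agg kernel
  split_ifs with h
  · simp only [add_mul, ite_mul, zero_mul, Finset.sum_add_distrib, Finset.sum_ite_eq',
      Finset.mem_univ, if_true, smul_eq_mul, Finset.mul_sum]
    congr 1
    exact Finset.sum_congr rfl fun _ _ => by ring
  · simp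

theorem sum_kernel (G : LabeledGraph d) (q : ℝ) (v : Fin G.n) :
    ∑ v', G.kernel q v v' = 1 := by
  have h := G.agg_eq_sum_kernel q (fun _ => 1) v
  simp only [mul_one] at h
  rw [← h]
  unfold agg
  split_ifs with hv
  · have hdeg : ∑ v', G.w v v' = G.deg v := rfl
    simp only [smul_eq_mul, mul_one, hdeg]
    field_simp
    ring
  · rfl

/-- Graphs with labels in `Z` and edge weights in `P`. -/
def withValuesIn (Z : Set (EuclideanSpace ℝ (Fin d))) (P : Set ℝ) : Set (LabeledGraph d) :=
  {G | (∀ v, G.label v ∈ Z) ∧ ∀ u v, G.w u v ≠ 0 → G.w u v ∈ P}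

theorem countable_withValuesIn {Z : Set (EuclideanSpace ℝ (Fin d))} {P : Set ℝ}
    (hZ : Z.Countable) (hP : P.Countable) : (withValuesIn Z P).Countable := by
  have : Countable Z := hZ.to_subtype
  have : Countable ↥(insert 0 P) := (hP.insert 0).to_subtype
  have hw : ∀ G ∈ withValuesIn Z P, ∀ u v, G.w u v ∈ insert 0 P := fun G hG u v => by
    by_cases h : G.w u v = 0
    · exact Or.inl h
    · exact Or.inr (hG.2 u v h)
  rw [← Set.countable_coe_iff]
  let F : withValuesIn Z P →
      Σ n : ℕ, (Fin n → Fin n → ↥(insert 0 P)) × (Fin n → Z) := fun G =>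
    ⟨G.1.n, fun u v => ⟨G.1.w u v, hw G.1 G.2 u v⟩, fun v => ⟨G.1.label v, G.2.1 v⟩⟩
  refine Function.Injective.countable (f := F) ?_
  rintro ⟨⟨n, hn, w, w0, ws, wl, l⟩, hG⟩ ⟨⟨n', hn', w', w0', ws', wl', l'⟩, hG'⟩ h
  obtain rfl : n = n' := congrArg Sigma.fst h
  have h2 := eq_of_heq (Sigma.mk.inj h).2
  obtain rfl : w = w' := by
    funext u v
    exact congrArg Subtype.val (congrFun (congrFun (congrArg Prod.fst h2) u) v)
  obtain rfl : l = l' := by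
    funext v
    exact congrArg Subtype.val (congrFun (congrArg Prod.snd h2) v)
  rfl

/-- Over a countable set of graphs, one Lipschitz map separates the node features, and its
averages separate the feature distributions under the kernels and the stationary measures. -/
theorem exists_separating_layer {X : Type*} [MetricSpace X] {S : Set (LabeledGraph d)}
    (hS : S.Countable) (q : ℝ) (e : ∀ G : LabeledGraph d, Fin G.n → X) :
    ∃ φ : X → ℝ, (∃ c : NNReal, LipschitzWith c φ) ∧
      ∀ G₁ ∈ S, ∀ G₂ ∈ S,
        (∀ a b, φ (e G₁ a) = φ (e G₂ b) → e G₁ a = e G₂ b) ∧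
        (∀ a b, agg q G₁ (fun v => φ (e G₁ v)) a = agg q G₂ (fun v => φ (e G₂ v)) b →
          pushforward (G₁.kernel q a) (fun v => φ (e G₁ v)) =
            pushforward (G₂.kernel q b) (fun v => φ (e G₂ v))) ∧
        (∑ v, G₁.statMeas v * φ (e G₁ v) = ∑ v, G₂.statMeas v * φ (e G₂ v) →
          pushforward G₁.statMeas (fun v => φ (e G₁ v)) =
            pushforward G₂.statMeas (fun v => φ (e G₂ v))) := by
  have : Countable S := hS.to_subtype
  let A₀ : Set (X →₀ ℝ) :=
    Set.range fun i : Σ G : S, Fin G.1.n => Finsupp.single (e i.1.1 i.2) (1 : ℝ)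
  let A₁ : Set (X →₀ ℝ) :=
    Set.range fun i : Σ G : S, Fin G.1.n => pushforward (i.1.1.kernel q i.2) (e i.1.1)
  let A₂ : Set (X →₀ ℝ) := Set.range fun G : S => pushforward G.1.statMeas (e G.1)
  obtain ⟨φ, hφ, hinj⟩ := exists_lipschitz_injOn_linearCombination (A₀ ∪ A₁ ∪ A₂)
    (((Set.countable_range _).union (Set.countable_range _)).union (Set.countable_range _))
  refine ⟨φ, hφ, fun G₁ h₁ G₂ h₂ => ⟨fun a b hab => ?_, fun a b hab => ?_, fun hab => ?_⟩⟩
  · have := hinj (Or.inl (Or.inl ⟨⟨⟨G₁, h₁⟩, a⟩, rfl⟩)) (Or.inl (Or.inl ⟨⟨⟨G₂, h₂⟩, b⟩, rfl⟩))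
      (by simpa using hab)
    exact (Finsupp.single_left_inj one_ne_zero).1 this
  · have := hinj (Or.inl (Or.inr ⟨⟨⟨G₁, h₁⟩, a⟩, rfl⟩)) (Or.inl (Or.inr ⟨⟨⟨G₂, h₂⟩, b⟩, rfl⟩))
      (by simpa only [linearCombination_pushforward, agg_eq_sum_kernel] using hab)
    simpa only [mapDomain_pushforward] using congrArg (Finsupp.mapDomain φ) this
  · have := hinj (Or.inr ⟨⟨G₁, h₁⟩, rfl⟩) (Or.inr ⟨⟨G₂, h₂⟩, rfl⟩)
      (by simpa only [linearCombination_pushforward] using hab)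
    simpa only [mapDomain_pushforward] using congrArg (Finsupp.mapDomain φ) this

/-- The transformed node features `φ_{j+1} ∘ ℓ_G^j` of a one-dimensional MP-GNN. -/
noncomputable def feat (q : ℝ) (φ₀ : EuclideanSpace ℝ (Fin d) → ℝ) (φ : ℕ → ℝ → ℝ)
    (G : LabeledGraph d) : ℕ → Fin G.n → ℝ
  | 0 => fun v => φ₀ (G.label v)
  | j + 1 => fun v => φ j (lab1 q G φ₀ φ j v)

theorem lab1_eq_agg_feat (q : ℝ) (φ₀ : EuclideanSpace ℝ (Fin d) → ℝ) (φ : ℕ → ℝ → ℝ)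
    (G : LabeledGraph d) (j : ℕ) : lab1 q G φ₀ φ j = agg q G (feat q φ₀ φ G j) := by
  cases j <;> rfl

theorem gnn1Out_eq_feat (q : ℝ) (φ₀ : EuclideanSpace ℝ (Fin d) → ℝ) (φ : ℕ → ℝ → ℝ)
    (ψ : ℝ → ℝ) (k : ℕ) (G : LabeledGraph d) :
    gnn1Out q φ₀ φ ψ k G = ψ (∑ v, G.statMeas v * feat q φ₀ φ G k v) := by
  cases k <;> rfl

theorem exists_isOneStepCoupling {q : ℝ} (hq0 : 0 ≤ q) (hq1 : q ≤ 1) (G₁ G₂ : LabeledGraph d)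
    (f : Fin G₁.n → ℝ) (g : Fin G₂.n → ℝ) :
    ∃ ν, IsOneStepCoupling (G₁.kernel q) (G₂.kernel q) ν ∧
      ∀ p, pushforward (G₁.kernel q p.1) f = pushforward (G₂.kernel q p.2) g →
        ∀ r, ν p r ≠ 0 → f r.1 = g r.2 := by
  have h : ∀ p : Fin G₁.n × Fin G₂.n, ∃ π, IsCouplingFn π (G₁.kernel q p.1) (G₂.kernel q p.2) ∧
      (pushforward (G₁.kernel q p.1) f = pushforward (G₂.kernel q p.2) g →
        ∀ r, π r ≠ 0 → f r.1 = g r.2) := by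
    intro p
    by_cases hp : pushforward (G₁.kernel q p.1) f = pushforward (G₂.kernel q p.2) g
    · obtain ⟨π, hπ, hs⟩ := exists_coupling_of_pushforward_eq (G₁.kernel_nonneg hq0 hq1 p.1)
        (G₂.kernel_nonneg hq0 hq1 p.2) f g hp
      exact ⟨π, hπ, fun _ => hs⟩
    · obtain ⟨π, hπ⟩ := exists_coupling_of_sum_eq (G₁.kernel_nonneg hq0 hq1 p.1)
        (G₂.kernel_nonneg hq0 hq1 p.2) (by rw [sum_kernel, sum_kernel])
      exact ⟨π, hπ, fun h => absurd h hp⟩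
  choose ν hν using h
  exact ⟨ν, fun p => (hν p).1, fun p => (hν p).2⟩

theorem exists_isKStepCoupling {q : ℝ} (hq0 : 0 ≤ q) (hq1 : q ≤ 1) (G₁ G₂ : LabeledGraph d)
    (f : ℕ → Fin G₁.n → ℝ) (g : ℕ → Fin G₂.n → ℝ)
    (h : ∀ j a b, f (j + 1) a = g (j + 1) b →
      pushforward (G₁.kernel q a) (f j) = pushforward (G₂.kernel q b) (g j)) (k : ℕ) :
    ∃ ν, IsKStepCoupling (G₁.kernel q) (G₂.kernel q) k ν ∧
      ∀ p, f k p.1 = g k p.2 → ∀ r, ν p r ≠ 0 → f 0 r.1 = g 0 r.2 := by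
  induction k with
  | zero =>
    refine ⟨fun p r => if r = p then 1 else 0, .zero _ fun _ _ => rfl, fun p hp r hr => ?_⟩
    obtain rfl : r = p := by
      by_contra hne
      simp [hne] at hr
    exact hp
  | succ k ih =>
    obtain ⟨ν', hν', hs'⟩ := ih
    obtain ⟨ν₁, hν₁, hs₁⟩ := exists_isOneStepCoupling hq0 hq1 G₁ G₂ (f k) (g k)
    refine ⟨fun p r => ∑ s, ν₁ p s * ν' s r, .succ k ν' ν₁ _ hν' hν₁ fun _ _ => rfl,
      fun p hp r hr => ?_⟩
    obtain ⟨s, -, hsr⟩ := Finset.exists_ne_zero_of_sum_ne_zero hr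
    exact hs' s (hs₁ p (h k _ _ hp) s (left_ne_zero_of_mul hsr)) r (right_ne_zero_of_mul hsr)

end LabeledGraph

theorem IsKStepCoupling.nonneg {A B : Type*} [Fintype A] [Fintype B] [DecidableEq A]
    [DecidableEq B] {mA : A → A → ℝ} {mB : B → B → ℝ} {k : ℕ} {ν : A × B → A × B → ℝ}
    (hν : IsKStepCoupling mA mB k ν) (p r : A × B) : 0 ≤ ν p r := by
  induction hν generalizing p with
  | zero ν h => rw [h]; split_ifs <;> simp
  | one ν h => exact (h p).1 r
  | succ k ν' ν₁ ν h' h₁ h ih =>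
    rw [h]
    exact Finset.sum_nonneg fun s _ => mul_nonneg ((h₁ p).1 s) (ih s)

namespace LabeledGraph

variable {d : ℕ}

theorem exists_abs_feat_sub_feat_le (q : ℝ) {φ₀ : EuclideanSpace ℝ (Fin d) → ℝ}
    {φ : ℕ → ℝ → ℝ} (h₀ : ∃ c : NNReal, LipschitzWith c φ₀)
    (h : ∀ i, ∃ c : NNReal, LipschitzWith c (φ i)) (G₁ G₂ : LabeledGraph d) (k : ℕ) :
    ∃ C : ℝ, 0 ≤ C ∧ ∀ ν, IsKStepCoupling (G₁.kernel q) (G₂.kernel q) k ν → ∀ p,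
      |feat q φ₀ φ G₁ k p.1 - feat q φ₀ φ G₂ k p.2| ≤
        C * ∑ r, ν p r * dist (G₁.label r.1) (G₂.label r.2) := by
  have hstep : ∀ j, ∃ c : ℝ, 0 ≤ c ∧ ∀ ν₁, IsOneStepCoupling (G₁.kernel q) (G₂.kernel q) ν₁ →
      ∀ p, |feat q φ₀ φ G₁ (j + 1) p.1 - feat q φ₀ φ G₂ (j + 1) p.2| ≤
        c * ∑ s, ν₁ p s * |feat q φ₀ φ G₁ j s.1 - feat q φ₀ φ G₂ j s.2| := by
    intro j
    obtain ⟨c, hc⟩ := h j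
    refine ⟨c, c.2, fun ν₁ hν₁ p => ?_⟩
    have h1 := hc.dist_le_mul (lab1 q G₁ φ₀ φ j p.1) (lab1 q G₂ φ₀ φ j p.2)
    rw [Real.dist_eq, Real.dist_eq] at h1
    refine h1.trans (mul_le_mul_of_nonneg_left ?_ c.2)
    rw [lab1_eq_agg_feat, lab1_eq_agg_feat, agg_eq_sum_kernel, agg_eq_sum_kernel]
    exact (hν₁ p).abs_sum_sub_sum_le _ _
  obtain ⟨c₀, hc₀⟩ := h₀
  have hbase : ∀ s : Fin G₁.n × Fin G₂.n, |feat q φ₀ φ G₁ 0 s.1 - feat q φ₀ φ G₂ 0 s.2| ≤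
      c₀ * dist (G₁.label s.1) (G₂.label s.2) := fun s => by
    rw [← Real.dist_eq]
    exact hc₀.dist_le_mul _ _
  induction k with
  | zero =>
    refine ⟨c₀, c₀.2, fun ν hν p => ?_⟩
    cases hν with
    | zero _ hz => simpa [hz] using hbase p
  | succ k ih =>
    obtain ⟨C, hC, hb⟩ := ih
    obtain ⟨c, hc, hs⟩ := hstep k
    have hcomp : ∀ ν' ν₁ ν : Fin G₁.n × Fin G₂.n → Fin G₁.n × Fin G₂.n → ℝ,
        IsKStepCoupling (G₁.kernel q) (G₂.kernel q) k ν' →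
        IsOneStepCoupling (G₁.kernel q) (G₂.kernel q) ν₁ →
        (∀ p r, ν p r = ∑ s, ν₁ p s * ν' s r) → ∀ p,
        |feat q φ₀ φ G₁ (k + 1) p.1 - feat q φ₀ φ G₂ (k + 1) p.2| ≤
          c * C * ∑ r, ν p r * dist (G₁.label r.1) (G₂.label r.2) := by
      intro ν' ν₁ ν hν' hν₁ hν p
      refine (hs ν₁ hν₁ p).trans ?_
      rw [mul_assoc]
      refine mul_le_mul_of_nonneg_left ?_ hc
      calc ∑ s, ν₁ p s * |feat q φ₀ φ G₁ k s.1 - feat q φ₀ φ G₂ k s.2|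
          ≤ ∑ s, ν₁ p s * (C * ∑ r, ν' s r * dist (G₁.label r.1) (G₂.label r.2)) :=
            Finset.sum_le_sum fun s _ =>
              mul_le_mul_of_nonneg_left (hb ν' hν' s) ((hν₁ p).1 s)
        _ = C * ∑ r, ν p r * dist (G₁.label r.1) (G₂.label r.2) := by
            simp only [hν, Finset.mul_sum, Finset.sum_mul]
            rw [Finset.sum_comm]
            exact Finset.sum_congr rfl fun _ _ => Finset.sum_congr rfl fun _ _ => by ring
    refine ⟨c * C, mul_nonneg hc hC, fun ν hν p => ?_⟩
    cases hν with
    | one _ h1 =>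
      exact hcomp (fun p r => if r = p then 1 else 0) ν ν (.zero _ fun _ _ => rfl) h1
        (fun p r => by simp) p
    | succ _ ν' ν₁ _ h' h₁ hcmp => exact hcomp ν' ν₁ ν h' h₁ hcmp p

theorem dGq_pos_of_gnn1Out_ne {q : ℝ} (hq0 : 0 ≤ q) (hq1 : q ≤ 1)
    {φ₀ : EuclideanSpace ℝ (Fin d) → ℝ} {φ : ℕ → ℝ → ℝ}
    (h₀ : ∃ c : NNReal, LipschitzWith c φ₀) (h : ∀ i, ∃ c : NNReal, LipschitzWith c (φ i))
    {G₁ G₂ : LabeledGraph d} {k : ℕ} {ψ : ℝ → ℝ}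
    (hne : gnn1Out q φ₀ φ ψ k G₁ ≠ gnn1Out q φ₀ φ ψ k G₂) : 0 < dGq q k G₁ G₂ := by
  obtain ⟨C, hC, hb⟩ := exists_abs_feat_sub_feat_le q h₀ h G₁ G₂ k
  rw [gnn1Out_eq_feat, gnn1Out_eq_feat] at hne
  set δ := |∑ v, G₁.statMeas v * feat q φ₀ φ G₁ k v - ∑ v, G₂.statMeas v * feat q φ₀ φ G₂ k v|
    with hδ
  have hδ0 : 0 < δ := abs_pos.2 (sub_ne_zero.2 fun h => hne (congrArg ψ h))
  have hC1 : 0 < C + 1 := by linarith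
  refine (div_pos hδ0 hC1).trans_le (le_csInf ?_ ?_)
  · obtain ⟨γ, hγ⟩ := exists_coupling_of_sum_eq G₁.statMeas_nonneg G₂.statMeas_nonneg
      (by rw [sum_statMeas, sum_statMeas])
    obtain ⟨ν, hν, -⟩ := exists_isKStepCoupling hq0 hq1 G₁ G₂ (fun j _ => j) (fun j _ => j)
      (fun j a b _ => by ext; simp [pushforward_apply, sum_kernel]) k
    exact ⟨_, γ, ν, hγ, hν, rfl⟩
  · rintro r ⟨γ, ν, hγ, hν, rfl⟩
    rw [div_le_iff₀' hC1]
    have hnn : 0 ≤ ∑ p, odotFn ν γ p * dist (G₁.label p.1) (G₂.label p.2) :=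
      Finset.sum_nonneg fun p _ => mul_nonneg
        (Finset.sum_nonneg fun s _ => mul_nonneg (hγ.1 s) (hν.nonneg s p)) dist_nonneg
    calc δ ≤ ∑ p, γ p * |feat q φ₀ φ G₁ k p.1 - feat q φ₀ φ G₂ k p.2| :=
          hγ.abs_sum_sub_sum_le _ _
      _ ≤ ∑ p, γ p * (C * ∑ r, ν p r * dist (G₁.label r.1) (G₂.label r.2)) :=
          Finset.sum_le_sum fun p _ => mul_le_mul_of_nonneg_left (hb ν hν p) (hγ.1 p)
      _ = C * ∑ p, odotFn ν γ p * dist (G₁.label p.1) (G₂.label p.2) := by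
          simp only [odotFn, Finset.mul_sum, Finset.sum_mul]
          rw [Finset.sum_comm]
          exact Finset.sum_congr rfl fun _ _ => Finset.sum_congr rfl fun _ _ => by ring
      _ ≤ (C + 1) * ∑ p, odotFn ν γ p * dist (G₁.label p.1) (G₂.label p.2) :=
          mul_le_mul_of_nonneg_right (by linarith) hnn

theorem dGq_nonpos_of_pushforward_eq {q : ℝ} (hq0 : 0 ≤ q) (hq1 : q ≤ 1)
    {G₁ G₂ : LabeledGraph d} {k : ℕ} (f : ℕ → Fin G₁.n → ℝ) (g : ℕ → Fin G₂.n → ℝ)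
    (hlabel : ∀ a b, f 0 a = g 0 b → G₁.label a = G₂.label b)
    (h : ∀ j a b, f (j + 1) a = g (j + 1) b →
      pushforward (G₁.kernel q a) (f j) = pushforward (G₂.kernel q b) (g j))
    (hk : pushforward G₁.statMeas (f k) = pushforward G₂.statMeas (g k)) :
    dGq q k G₁ G₂ ≤ 0 := by
  obtain ⟨γ, hγ, hsγ⟩ := exists_coupling_of_pushforward_eq G₁.statMeas_nonneg
    G₂.statMeas_nonneg _ _ hk
  obtain ⟨ν, hν, hsν⟩ := exists_isKStepCoupling hq0 hq1 G₁ G₂ f g h k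
  refine csInf_le ⟨0, ?_⟩ ⟨γ, ν, hγ, hν, ?_⟩
  · rintro r ⟨γ, ν, hγ, hν, rfl⟩
    exact Finset.sum_nonneg fun p _ => mul_nonneg
      (Finset.sum_nonneg fun s _ => mul_nonneg (hγ.1 s) (hν.nonneg s p)) dist_nonneg
  · refine (Finset.sum_eq_zero fun r _ => ?_).symm
    by_contra hr
    obtain ⟨p, -, hp⟩ := Finset.exists_ne_zero_of_sum_ne_zero (left_ne_zero_of_mul hr)
    have hlab := hlabel _ _ (hsν p (hsγ p (left_ne_zero_of_mul hp)) r (right_ne_zero_of_mul hp))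
    exact right_ne_zero_of_mul hr (by rw [hlab, dist_self])

end LabeledGraph

/-!
STATEMENT 11: Fix `q ∈ (0,1)`, `d ≥ 1`, `k ∈ ℕ`, a countable `Z ⊆ ℝ^d` and a countable
`P ⊆ (0,∞)`. Then there exists a single `k`-layer MP-GNN `h` with damping `q`, whose
intermediate dimensions are all `1` (`φ_1 : ℝ^d → ℝ` and `φ_2,…,φ_{k+1}, ψ : ℝ → ℝ` are
Lipschitz), such that for all labeled weighted graphs with vertex labels in `Z` and edge
weights in `P`: `d_{G,q}^{(k)}(G₁,G₂) > 0` iff `h(G₁) ≠ h(G₂)`.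
-/
theorem exists_universal_one_dim_mpgnn (q : ℝ) (hq0 : 0 < q) (hq1 : q < 1)
    (d : ℕ) (hd : 1 ≤ d) (k : ℕ)
    (Z : Set (EuclideanSpace ℝ (Fin d))) (hZ : Z.Countable)
    (P : Set ℝ) (hP : P.Countable) (hPpos : ∀ p ∈ P, 0 < p) :
    ∃ (φ₀ : EuclideanSpace ℝ (Fin d) → ℝ) (φ : ℕ → ℝ → ℝ) (ψ : ℝ → ℝ),
      (∃ c : NNReal, LipschitzWith c φ₀) ∧ (∀ i, ∃ c : NNReal, LipschitzWith c (φ i)) ∧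
      (∃ c : NNReal, LipschitzWith c ψ) ∧
      ∀ G₁ G₂ : LabeledGraph d,
        (∀ v, G₁.label v ∈ Z) → (∀ u v, G₁.w u v ≠ 0 → G₁.w u v ∈ P) →
        (∀ v, G₂.label v ∈ Z) → (∀ u v, G₂.w u v ≠ 0 → G₂.w u v ∈ P) →
        (0 < dGq q k G₁ G₂ ↔ gnn1Out q φ₀ φ ψ k G₁ ≠ gnn1Out q φ₀ φ ψ k G₂) := by
  set S := LabeledGraph.withValuesIn Z P
  have hS : S.Countable := LabeledGraph.countable_withValuesIn hZ hP
  obtain ⟨φ₀, hφ₀, hsep₀⟩ := LabeledGraph.exists_separating_layer hS q LabeledGraph.label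
  choose Φ hΦ hsep using fun e : ∀ G : LabeledGraph d, Fin G.n → ℝ =>
    LabeledGraph.exists_separating_layer hS q e
  let F : ℕ → ∀ G : LabeledGraph d, Fin G.n → ℝ := fun j =>
    Nat.rec (fun G => agg q G (fun v => φ₀ (G.label v)))
      (fun _ F G => agg q G (fun v => Φ F (F G v))) j
  let φ : ℕ → ℝ → ℝ := fun j => Φ (F j)
  have hF : ∀ j, (fun G => lab1 q G φ₀ φ j) = F j := by
    intro j
    induction j with
    | zero => rfl
    | succ j ih =>
      funext G
      have : lab1 q G φ₀ φ j = F j G := congrFun ih G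
      change agg q G (fun v => φ j (lab1 q G φ₀ φ j v)) = agg q G (fun v => φ j (F j G v))
      rw [this]
  have hφ : ∀ j, ∃ c : NNReal, LipschitzWith c (φ j) := fun j => hΦ (F j)
  refine ⟨φ₀, φ, id, hφ₀, hφ, ⟨1, LipschitzWith.id⟩, fun G₁ G₂ hl₁ hw₁ hl₂ hw₂ => ?_⟩
  have h₁ : G₁ ∈ S := ⟨hl₁, hw₁⟩
  have h₂ : G₂ ∈ S := ⟨hl₂, hw₂⟩
  have hfeat : ∀ G j, LabeledGraph.feat q φ₀ φ G (j + 1) = fun v => Φ (F j) (F j G v) :=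
    fun G j => funext fun v => congrArg (Φ (F j)) (congrFun (congrFun (hF j) G) v)
  have hstep : ∀ j a b,
      LabeledGraph.feat q φ₀ φ G₁ (j + 1) a = LabeledGraph.feat q φ₀ φ G₂ (j + 1) b →
      lab1 q G₁ φ₀ φ j a = lab1 q G₂ φ₀ φ j b := by
    intro j a b hab
    rw [hfeat, hfeat] at hab
    have hF' : ∀ G, lab1 q G φ₀ φ j = F j G := fun G => congrFun (hF j) G
    rw [hF', hF']
    exact (hsep (F j) G₁ h₁ G₂ h₂).1 a b hab
  have hpush : ∀ j,
      (∀ a b, agg q G₁ (LabeledGraph.feat q φ₀ φ G₁ j) a =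
          agg q G₂ (LabeledGraph.feat q φ₀ φ G₂ j) b →
        pushforward (G₁.kernel q a) (LabeledGraph.feat q φ₀ φ G₁ j) =
          pushforward (G₂.kernel q b) (LabeledGraph.feat q φ₀ φ G₂ j)) ∧
      (∑ v, G₁.statMeas v * LabeledGraph.feat q φ₀ φ G₁ j v =
          ∑ v, G₂.statMeas v * LabeledGraph.feat q φ₀ φ G₂ j v →
        pushforward G₁.statMeas (LabeledGraph.feat q φ₀ φ G₁ j) =
          pushforward G₂.statMeas (LabeledGraph.feat q φ₀ φ G₂ j)) := by
    intro j
    cases j with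
    | zero => exact (hsep₀ G₁ h₁ G₂ h₂).2
    | succ j =>
      rw [hfeat, hfeat]
      exact (hsep (F j) G₁ h₁ G₂ h₂).2
  refine ⟨fun hpos heq => ?_, LabeledGraph.dGq_pos_of_gnn1Out_ne hq0.le hq1.le hφ₀ hφ⟩
  rw [LabeledGraph.gnn1Out_eq_feat, LabeledGraph.gnn1Out_eq_feat] at heq
  refine hpos.not_ge (LabeledGraph.dGq_nonpos_of_pushforward_eq hq0.le hq1.le
    (LabeledGraph.feat q φ₀ φ G₁) (LabeledGraph.feat q φ₀ φ G₂)
    (hsep₀ G₁ h₁ G₂ h₂).1 (fun j a b hab => (hpush j).1 a b ?_) ((hpush k).2 heq))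
  rw [← LabeledGraph.lab1_eq_agg_feat, ← LabeledGraph.lab1_eq_agg_feat]
  exact hstep j a b hab
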